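/- Let K be a locally compact Hausdorff space, let X = (xᵢ)_{i∈ℕ} be a sequence in C_b(K) which is an external admissible system for C₀(K), and let Φ = (φ_k)_{k∈ℕ} be a sequence of states on C₀(K). Then the function ν_{X,Φ} defined on C₀(K) by ν_{X,Φ}(x)² = sup_k ∑_{i=k}^∞ |φ_k(x̄·xᵢ)|² is a well-defined (finite-valued) seminorm on C₀(K): ν_{X,Φ}(x) < ∞, ν_{X,Φ}(λx) = |λ|·ν_{X,Φ}(x) for all λ ∈ ℂ, and ν_{X,Φ}(x + y) ≤ ν_{X,Φ}(x) + ν_{X,Φ}(y) for all x, y ∈ C₀(K). -/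

import Mathlib

open scoped ZeroAtInfty BoundedContinuousFunction ComplexOrder
open Filter

/-- The `C₀(K)`-valued inner product `⟨x, y⟩ = x̄·y` of `x ∈ C₀(K)` with a multiplier
`y ∈ C_b(K)`. -/
noncomputable def mulIP {K : Type*} [TopologicalSpace K]
    (x : C₀(K, ℂ)) (y : K →ᵇ ℂ) : C₀(K, ℂ) where
  toFun := fun t => star (x t) * y t
  continuous_toFun := ((map_continuous x).star).mul y.continuous
  zero_at_infty' := by
    have htend : Tendsto (fun t => ‖x t‖ * ‖y‖) (cocompact K) (nhds 0) := by
      have hx : Tendsto (fun t => ‖x t‖) (cocompact K) (nhds 0) := by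
        simpa using (x.zero_at_infty').norm
      simpa using hx.mul_const ‖y‖
    refine squeeze_zero_norm (fun t => ?_) htend
    calc ‖star (x t) * y t‖ ≤ ‖star (x t)‖ * ‖y t‖ := norm_mul_le _ _
      _ ≤ ‖x t‖ * ‖y‖ := by
          rw [norm_star]
          exact mul_le_mul_of_nonneg_left (y.norm_coe_le_norm t) (norm_nonneg _)

/-- A sequence `X` in `C_b(K)` is an external admissible system for `C₀(K)` if:
(1) for every `x ∈ C₀(K)` the series `∑ᵢ ⟨x,xᵢ⟩⟨xᵢ,x⟩ = ∑ᵢ |xᵢ|²|x|²` converges uniformly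
(i.e. in the supremum norm); (2) its sum is bounded pointwise by `⟨x,x⟩ = |x|²`;
(3) `‖xᵢ‖ ≤ 1` for all `i`. -/
def IsExternalAdmissible {K : Type*} [TopologicalSpace K] (X : ℕ → (K →ᵇ ℂ)) : Prop :=
  (∀ x : C₀(K, ℂ), ∃ g : K → ℝ,
      TendstoUniformly
        (fun n (t : K) => ∑ i ∈ Finset.range n, ‖X i t‖ ^ 2 * ‖x t‖ ^ 2) g atTop ∧
      ∀ t : K, g t ≤ ‖x t‖ ^ 2) ∧
  ∀ i, ‖X i‖ ≤ 1

/-- A state on `C₀(K)`: a positive continuous linear functional of norm one. -/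
def IsStateC0 {K : Type*} [TopologicalSpace K] (φ : C₀(K, ℂ) →L[ℂ] ℂ) : Prop :=
  (∀ f : C₀(K, ℂ), (∀ t : K, 0 ≤ f t) → 0 ≤ φ f) ∧ ‖φ‖ = 1

/-- The function `ν_{X,Φ}`, with `ν_{X,Φ}(x)² = sup_k ∑_{i=k}^∞ |φ_k(⟨x, xᵢ⟩)|²`. -/
noncomputable def nuXPhi {K : Type*} [TopologicalSpace K]
    (X : ℕ → (K →ᵇ ℂ)) (φ : ℕ → (C₀(K, ℂ) →L[ℂ] ℂ)) (x : C₀(K, ℂ)) : ℝ :=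
  Real.sqrt (⨆ k : ℕ, ∑' i : ℕ, ‖φ k (mulIP x (X (k + i)))‖ ^ 2)

lemma C0_norm_le {K : Type*} [TopologicalSpace K] (f : C₀(K, ℂ)) (C : ℝ) (hC : 0 ≤ C)
    (h : ∀ t, ‖f t‖ ≤ C) : ‖f‖ ≤ C := by
  rw [← ZeroAtInftyContinuousMap.norm_toBCF_eq_norm]
  exact (BoundedContinuousFunction.norm_le hC).2 h

lemma C0_coe_le {K : Type*} [TopologicalSpace K] (f : C₀(K, ℂ)) (t : K) : ‖f t‖ ≤ ‖f‖ := by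
  rw [← ZeroAtInftyContinuousMap.norm_toBCF_eq_norm]
  exact f.toBCF.norm_coe_le_norm t

lemma adm_sum_le {K : Type*} [TopologicalSpace K] {X : ℕ → (K →ᵇ ℂ)}
    (hX : IsExternalAdmissible X) (x : C₀(K, ℂ)) (F : Finset ℕ) (t : K) :
    ∑ i ∈ F, ‖X i t‖ ^ 2 * ‖x t‖ ^ 2 ≤ ‖x‖ ^ 2 := by
  obtain ⟨g, hg, hb⟩ := hX.1 x
  have h1 := hg.tendsto_at t
  have hs : HasSum (fun i => ‖X i t‖ ^ 2 * ‖x t‖ ^ 2) (g t) :=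
    (hasSum_iff_tendsto_nat_of_nonneg (fun i => by positivity) _).2 h1
  have h2 : ‖x t‖ ^ 2 ≤ ‖x‖ ^ 2 := by
    have := C0_coe_le x t
    gcongr
  exact ((sum_le_hasSum F (fun i _ => by positivity) hs).trans (hb t)).trans h2

lemma bessel {K : Type*} [TopologicalSpace K] {X : ℕ → (K →ᵇ ℂ)}
    (hX : IsExternalAdmissible X) (φ : C₀(K, ℂ) →L[ℂ] ℂ) (hφ : IsStateC0 φ)
    (x : C₀(K, ℂ)) (F : Finset ℕ) :
    ∑ i ∈ F, ‖φ (mulIP x (X i))‖ ^ 2 ≤ ‖x‖ ^ 2 := by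
  set S := ∑ i ∈ F, ‖φ (mulIP x (X i))‖ ^ 2 with hS
  have hS0 : 0 ≤ S := Finset.sum_nonneg fun i _ => by positivity
  let f : C₀(K, ℂ) := ∑ i ∈ F, (star (φ (mulIP x (X i)))) • mulIP x (X i)
  have hf : φ f = (S : ℂ) := by
    simp only [f, map_sum, map_smul, smul_eq_mul, hS, Complex.ofReal_sum]
    refine Finset.sum_congr rfl fun i _ => ?_
    rw [Complex.star_def, Complex.conj_mul']
    simp
  have hn : ‖f‖ ≤ √S * ‖x‖ := by
    refine C0_norm_le _ _ (by positivity) fun t => ?_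
    have e : f t = ∑ i ∈ F, (star (φ (mulIP x (X i)))) * (star (x t) * X i t) := by
      have : ∀ G : Finset ℕ, (∑ i ∈ G, (star (φ (mulIP x (X i)))) • mulIP x (X i)) t
          = ∑ i ∈ G, (star (φ (mulIP x (X i)))) * (star (x t) * X i t) := by
        intro G
        induction G using Finset.induction_on with
        | empty => simp
        | insert a s ha ih =>
          rw [Finset.sum_insert ha, Finset.sum_insert ha, ← ih]
          rfl
      exact this F
    rw [e]
    calc _ ≤ ∑ i ∈ F, ‖φ (mulIP x (X i))‖ * (‖X i t‖ * ‖x t‖) := by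
          refine (norm_sum_le _ _).trans (le_of_eq (Finset.sum_congr rfl fun i _ => ?_))
          rw [norm_mul, norm_mul, norm_star, norm_star]
          ring
      _ ≤ √S * √(∑ i ∈ F, (‖X i t‖ * ‖x t‖) ^ 2) := Real.sum_mul_le_sqrt_mul_sqrt _ _ _
      _ ≤ √S * ‖x‖ := by
          gcongr
          refine Real.sqrt_le_iff.2 ⟨norm_nonneg _, ?_⟩
          simpa only [mul_pow] using adm_sum_le hX x F t
  have h1 : S ≤ √S * ‖x‖ := by
    have := φ.le_opNorm f
    rw [hφ.2, hf, one_mul, Complex.norm_real, Real.norm_of_nonneg hS0] at this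
    exact this.trans hn
  have h2 := Real.sq_sqrt hS0
  nlinarith [sq_nonneg (√S - ‖x‖), sq_nonneg (‖x‖)]

lemma bessel_shift {K : Type*} [TopologicalSpace K] {X : ℕ → (K →ᵇ ℂ)}
    (hX : IsExternalAdmissible X) (φ : C₀(K, ℂ) →L[ℂ] ℂ) (hφ : IsStateC0 φ)
    (x : C₀(K, ℂ)) (k : ℕ) (F : Finset ℕ) :
    ∑ i ∈ F, ‖φ (mulIP x (X (k + i)))‖ ^ 2 ≤ ‖x‖ ^ 2 := by
  simpa using bessel hX φ hφ x (F.map (addLeftEmbedding k))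

lemma mulIP_smul {K : Type*} [TopologicalSpace K] (c : ℂ) (x : C₀(K, ℂ)) (y : K →ᵇ ℂ) :
    mulIP (c • x) y = star c • mulIP x y := by
  ext t
  change star (c * x t) * y t = star c * (star (x t) * y t)
  rw [star_mul']
  ring

lemma mulIP_add {K : Type*} [TopologicalSpace K] (x z : C₀(K, ℂ)) (y : K →ᵇ ℂ) :
    mulIP (x + z) y = mulIP x y + mulIP z y := by
  ext t
  change star (x t + z t) * y t = star (x t) * y t + star (z t) * y t
  rw [star_add]
  ring

/-- For an external admissible system `X ⊆ C_b(K)` for `C₀(K)` and a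
sequence `Φ` of states on `C₀(K)`, the function `ν_{X,Φ}` is a well-defined finite-valued
seminorm on `C₀(K)`: all the tail series converge and are uniformly bounded over `k`
(so the sup is finite), `ν_{X,Φ}` is absolutely homogeneous, and it satisfies the triangle
inequality. -/
theorem nuXPhi_is_seminorm {K : Type*} [TopologicalSpace K] [LocallyCompactSpace K]
    [T2Space K] (X : ℕ → (K →ᵇ ℂ)) (hX : IsExternalAdmissible X)
    (φ : ℕ → (C₀(K, ℂ) →L[ℂ] ℂ)) (hφ : ∀ k, IsStateC0 (φ k)) :
    (∀ (x : C₀(K, ℂ)) (k : ℕ),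
        Summable fun i : ℕ => ‖φ k (mulIP x (X (k + i)))‖ ^ 2) ∧
    (∀ x : C₀(K, ℂ),
        BddAbove (Set.range fun k : ℕ => ∑' i : ℕ, ‖φ k (mulIP x (X (k + i)))‖ ^ 2)) ∧
    (∀ (c : ℂ) (x : C₀(K, ℂ)), nuXPhi X φ (c • x) = ‖c‖ * nuXPhi X φ x) ∧
    (∀ x y : C₀(K, ℂ), nuXPhi X φ (x + y) ≤ nuXPhi X φ x + nuXPhi X φ y) := by
  have hsum : ∀ (x : C₀(K, ℂ)) (k : ℕ),
      Summable fun i : ℕ => ‖φ k (mulIP x (X (k + i)))‖ ^ 2 := fun x k =>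
    summable_of_sum_le (fun i => by positivity) (bessel_shift hX (φ k) (hφ k) x k)
  have hbdd : ∀ x : C₀(K, ℂ),
      BddAbove (Set.range fun k : ℕ => ∑' i : ℕ, ‖φ k (mulIP x (X (k + i)))‖ ^ 2) := by
    intro x
    refine ⟨‖x‖ ^ 2, ?_⟩
    rintro _ ⟨k, rfl⟩
    exact Real.tsum_le_of_sum_le (fun i => by positivity) (bessel_shift hX (φ k) (hφ k) x k)
  refine ⟨hsum, hbdd, ?_, ?_⟩
  · intro c x
    have : ∀ k i, ‖φ k (mulIP (c • x) (X (k + i)))‖ ^ 2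
        = ‖c‖ ^ 2 * ‖φ k (mulIP x (X (k + i)))‖ ^ 2 := by
      intro k i
      rw [mulIP_smul, map_smul, norm_smul, norm_star, mul_pow]
    simp only [nuXPhi, this, tsum_mul_left]
    rw [← Real.mul_iSup_of_nonneg (by positivity), Real.sqrt_mul (by positivity),
      Real.sqrt_sq (norm_nonneg _)]
  · intro x y
    have key : ∀ (x : C₀(K, ℂ)) (k : ℕ) (F : Finset ℕ),
        √(∑ i ∈ F, ‖φ k (mulIP x (X (k + i)))‖ ^ 2) ≤ nuXPhi X φ x := by
      intro x k F
      refine Real.sqrt_le_sqrt ?_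
      exact ((hsum x k).sum_le_tsum F (fun i _ => by positivity)).trans (le_ciSup (hbdd x) k)
    have hA : 0 ≤ nuXPhi X φ x := Real.sqrt_nonneg _
    have hB : 0 ≤ nuXPhi X φ y := Real.sqrt_nonneg _
    refine Real.sqrt_le_iff.2 ⟨by positivity, ?_⟩
    refine ciSup_le fun k => Real.tsum_le_of_sum_le (fun i => by positivity) fun F => ?_
    have k1 := key x k F
    have k2 := key y k F
    have cs := Real.sum_mul_le_sqrt_mul_sqrt F (fun i => ‖φ k (mulIP x (X (k + i)))‖)
      (fun i => ‖φ k (mulIP y (X (k + i)))‖)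
    have s1 : ∑ i ∈ F, ‖φ k (mulIP x (X (k + i)))‖ ^ 2 ≤ nuXPhi X φ x ^ 2 :=
      (Real.sqrt_le_left hA).1 k1
    have s2 : ∑ i ∈ F, ‖φ k (mulIP y (X (k + i)))‖ ^ 2 ≤ nuXPhi X φ y ^ 2 :=
      (Real.sqrt_le_left hB).1 k2
    have s3 := cs.trans (mul_le_mul k1 k2 (Real.sqrt_nonneg _) hA)
    calc _ ≤ ∑ i ∈ F, (‖φ k (mulIP x (X (k + i)))‖ ^ 2
          + 2 * (‖φ k (mulIP x (X (k + i)))‖ * ‖φ k (mulIP y (X (k + i)))‖)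
          + ‖φ k (mulIP y (X (k + i)))‖ ^ 2) := by
          refine Finset.sum_le_sum fun i _ => ?_
          rw [mulIP_add, map_add]
          have := norm_add_le (φ k (mulIP x (X (k + i)))) (φ k (mulIP y (X (k + i))))
          have := pow_le_pow_left₀ (norm_nonneg _) this 2
          linarith
      _ ≤ _ := by
          rw [Finset.sum_add_distrib, Finset.sum_add_distrib, ← Finset.mul_sum]
          linarith
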